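/- Let λ be a partition with |λ| = k. Then for every natural number n, the sum of wt(T) over all oscillating tableaux T of shape λ and length k+2n equals (1/6)·(4n² + 3k² + 8kn + 2n + 3k) times the number of oscillating tableaux of shape λ and length k+2n. Equivalently, the average weight of an oscillating tableau of shape λ and length k+2n is (1/6)(4n² + 3k² + 8kn + 2n + 3k). -/

import Mathlib

/-- `ν` covers `μ` in Young's lattice: the Young diagram of `ν` is obtained from that of `μ`
by adding one box. -/
def YCov (μ ν : YoungDiagram) : Prop := μ ≤ ν ∧ ν.card = μ.card + 1

/-- `T` is an oscillating tableau of shape `lam` and length `l`: a sequence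
`(λ⁰, λ¹, …, λˡ)` of partitions with `λ⁰ = ∅`, `λˡ = lam`, and consecutive terms
differing by adding or removing a single box. -/
def IsOscTab (lam : YoungDiagram) (l : ℕ) (T : Fin (l + 1) → YoungDiagram) : Prop :=
  T 0 = ⊥ ∧ T (Fin.last l) = lam ∧
    ∀ i : Fin l, YCov (T i.castSucc) (T i.succ) ∨ YCov (T i.succ) (T i.castSucc)

/-- The set `OT(lam, l)` of oscillating tableaux of shape `lam` and length `l`. -/
def OscTab (lam : YoungDiagram) (l : ℕ) := {T : Fin (l + 1) → YoungDiagram // IsOscTab lam l T}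

/-- The weight of an oscillating tableau: the sum of the sizes of all partitions it visits. -/
def oscWt {lam : YoungDiagram} {l : ℕ} (T : OscTab lam l) : ℕ := ∑ i, (T.1 i).card

section

open Finset

namespace YoungDiagram

/-- A box can be added at the end of row `i`. -/
def Addable (μ : YoungDiagram) (i : ℕ) : Prop := i = 0 ∨ μ.rowLen i < μ.rowLen (i - 1)

/-- The last box of row `i` can be removed. -/
def Removable (μ : YoungDiagram) (i : ℕ) : Prop := μ.rowLen (i + 1) < μ.rowLen i

open Classical in
/-- Add a box to row `i` if possible; otherwise leave the diagram unchanged. -/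
noncomputable def addBox (μ : YoungDiagram) (i : ℕ) : YoungDiagram :=
  if h : μ.Addable i then
    { cells := insert (i, μ.rowLen i) μ.cells
      isLowerSet := by
        rintro ⟨a, b⟩ ⟨c, d⟩ ⟨hca, hdb⟩ hab
        simp only [coe_insert, Set.mem_insert_iff, Prod.mk.injEq, mem_coe, mem_cells,
          mem_iff_lt_rowLen] at hab hca hdb ⊢
        rcases hab with ⟨rfl, rfl⟩ | hab
        · rcases eq_or_lt_of_le hca with rfl | hlt
          · omega
          · have := μ.rowLen_anti c (a - 1) (by omega)
            rcases h with h | h <;> omega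
        · have := μ.rowLen_anti c a hca
          omega }
  else μ

open Classical in
/-- Remove the last box of row `i` if possible; otherwise leave the diagram unchanged. -/
noncomputable def delBox (μ : YoungDiagram) (i : ℕ) : YoungDiagram :=
  if h : μ.Removable i then
    { cells := μ.cells.erase (i, μ.rowLen i - 1)
      isLowerSet := by
        rintro ⟨a, b⟩ ⟨c, d⟩ ⟨hca, hdb⟩ hab
        simp only [coe_erase, Set.mem_sdiff, Set.mem_singleton_iff, Prod.mk.injEq, mem_coe,
          mem_cells, mem_iff_lt_rowLen] at hab hca hdb ⊢
        have h1 := μ.rowLen_anti c a hca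
        refine ⟨by omega, ?_⟩
        rintro ⟨rfl, rfl⟩
        rcases eq_or_lt_of_le hca with rfl | hlt
        · omega
        · have := μ.rowLen_anti (c + 1) a hlt
          unfold Removable at h
          omega }
  else μ

lemma cells_addBox {μ : YoungDiagram} {i : ℕ} (h : μ.Addable i) :
    (μ.addBox i).cells = insert (i, μ.rowLen i) μ.cells := by
  simp [addBox, h]

lemma cells_delBox {μ : YoungDiagram} {i : ℕ} (h : μ.Removable i) :
    (μ.delBox i).cells = μ.cells.erase (i, μ.rowLen i - 1) := by
  simp [delBox, h]

open Classical in
/-- The diagrams covering `μ` in Young's lattice. -/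
noncomputable def up (μ : YoungDiagram) : Finset YoungDiagram :=
  ((range (μ.colLen 0 + 1)).filter μ.Addable).image μ.addBox

open Classical in
/-- The diagrams covered by `μ` in Young's lattice. -/
noncomputable def down (μ : YoungDiagram) : Finset YoungDiagram :=
  ((range (μ.colLen 0)).filter μ.Removable).image μ.delBox

lemma lt_colLen_zero_iff {μ : YoungDiagram} {i : ℕ} : i < μ.colLen 0 ↔ 0 < μ.rowLen i := by
  rw [← mem_iff_lt_colLen, mem_iff_lt_rowLen]

lemma exists_cells_eq_insert {μ ν : YoungDiagram} (h : YCov μ ν) :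
    ∃ c, c ∉ μ.cells ∧ ν.cells = insert c μ.cells := by
  obtain ⟨hle, hcard⟩ := h
  have hd : #(ν.cells \ μ.cells) = 1 := by
    rw [card_sdiff_of_subset (cells_subset_iff.2 hle)]
    simp only [YoungDiagram.card] at hcard
    omega
  obtain ⟨c, hc⟩ := card_eq_one.1 hd
  have hc' : c ∈ ν.cells \ μ.cells := by simp [hc]
  refine ⟨c, (mem_sdiff.1 hc').2, ?_⟩
  rw [← sdiff_union_of_subset (cells_subset_iff.2 hle), hc]
  rfl

lemma mem_up {μ ν : YoungDiagram} : ν ∈ μ.up ↔ YCov μ ν := by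
  classical
  simp only [up, mem_image, mem_filter, mem_range]
  constructor
  · rintro ⟨i, ⟨-, hi⟩, rfl⟩
    have hn : (i, μ.rowLen i) ∉ μ.cells := by simp [mem_iff_lt_rowLen]
    refine ⟨cells_subset_iff.1 ?_, ?_⟩
    · rw [cells_addBox hi]; exact subset_insert _ _
    · rw [YoungDiagram.card, cells_addBox hi, card_insert_of_notMem hn]
  · intro h
    obtain ⟨⟨i, j⟩, hc, hν⟩ := exists_cells_eq_insert h
    have hmem : ∀ a b, (a, b) ∈ ν ↔ (a = i ∧ b = j) ∨ b < μ.rowLen a := by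
      intro a b
      rw [← mem_cells, hν]
      simp [mem_iff_lt_rowLen]
    rw [mem_cells, mem_iff_lt_rowLen] at hc
    have hij : (i, j) ∈ ν := by simp [hmem]
    have hj : j = μ.rowLen i := by
      by_contra hne
      have := (hmem _ _).1 (ν.up_left_mem le_rfl (show μ.rowLen i ≤ j by omega) hij)
      omega
    have hadd : μ.Addable i := by
      by_contra hna
      simp only [Addable, not_or, not_lt] at hna
      have := (hmem _ _).1 (ν.up_left_mem (show i - 1 ≤ i by omega) le_rfl hij)
      omega
    refine ⟨i, ⟨?_, hadd⟩, ?_⟩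
    · rcases hadd with h | h
      · omega
      · have := lt_colLen_zero_iff.2 (show 0 < μ.rowLen (i - 1) by omega)
        omega
    · ext1
      rw [cells_addBox hadd, hν, hj]

lemma mem_down {μ ν : YoungDiagram} : μ ∈ ν.down ↔ YCov μ ν := by
  classical
  simp only [down, mem_image, mem_filter, mem_range]
  constructor
  · rintro ⟨i, ⟨-, hi⟩, rfl⟩
    have hn : (i, ν.rowLen i - 1) ∈ ν.cells := by
      have : ν.rowLen (i + 1) < ν.rowLen i := hi
      simp only [mem_cells, mem_iff_lt_rowLen]
      omega
    refine ⟨cells_subset_iff.1 ?_, ?_⟩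
    · rw [cells_delBox hi]; exact erase_subset _ _
    · rw [YoungDiagram.card, YoungDiagram.card, cells_delBox hi, card_erase_add_one hn]
  · intro h
    obtain ⟨⟨i, j⟩, hc, hν⟩ := exists_cells_eq_insert h
    have hmem : ∀ a b, b < ν.rowLen a ↔ (a = i ∧ b = j) ∨ (a, b) ∈ μ := by
      intro a b
      rw [← mem_iff_lt_rowLen, ← mem_cells, hν]
      simp
    have hij : j < ν.rowLen i := by simp [hmem]
    have hj : j = ν.rowLen i - 1 := by
      by_contra hne
      rcases (hmem i (j + 1)).1 (by omega) with h | h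
      · omega
      · exact hc (μ.up_left_mem le_rfl (by omega) h)
    have hrem : ν.Removable i := by
      by_contra hna
      simp only [Removable, not_lt] at hna
      rcases (hmem (i + 1) j).1 (by omega) with h | h
      · omega
      · exact hc (μ.up_left_mem (by omega) le_rfl h)
    refine ⟨i, ⟨lt_colLen_zero_iff.2 (by omega), hrem⟩, ?_⟩
    ext1
    rw [cells_delBox hrem, ← hj, hν, erase_insert hc]

lemma addable_zero (μ : YoungDiagram) : μ.Addable 0 := Or.inl rfl

lemma addable_succ {μ : YoungDiagram} {i : ℕ} : μ.Addable (i + 1) ↔ μ.Removable i := by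
  simp [Addable, Removable]

lemma card_up (μ : YoungDiagram) : #μ.up = #μ.down + 1 := by
  classical
  rw [up, down, card_image_of_injOn, card_image_of_injOn, card_filter, card_filter,
    sum_range_succ']
  · simp only [addable_zero, addable_succ, if_true]
  · intro i hi i' hi' h
    simp only [coe_filter, Set.mem_ofPred_eq] at hi hi'
    have hlt : ∀ {i}, μ.Removable i → (i, μ.rowLen i - 1) ∈ μ.cells := fun {i} hr => by
      have : μ.rowLen (i + 1) < μ.rowLen i := hr
      simp only [mem_cells, mem_iff_lt_rowLen]
      omega
    have h' := congrArg cells h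
    rw [cells_delBox hi.2, cells_delBox hi'.2] at h'
    by_contra hne
    have : (i, μ.rowLen i - 1) ∈ μ.cells.erase (i', μ.rowLen i' - 1) :=
      mem_erase.2 ⟨fun h => hne (congrArg Prod.fst h), hlt hi.2⟩
    rw [← h'] at this
    simp at this
  · intro i hi i' hi' h
    simp only [coe_filter, Set.mem_ofPred_eq] at hi hi'
    have h' := congrArg cells h
    rw [cells_addBox hi.2, cells_addBox hi'.2] at h'
    have : (i, μ.rowLen i) ∈ insert (i', μ.rowLen i') μ.cells := by
      rw [← h']; exact mem_insert_self _ _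
    rcases mem_insert.1 this with h | h
    · exact congrArg Prod.fst h
    · simp [mem_iff_lt_rowLen] at h

lemma card_sup_add_card_inf (μ ν : YoungDiagram) :
    (μ ⊔ ν).card + (μ ⊓ ν).card = μ.card + ν.card :=
  card_union_add_card_inter _ _

lemma eq_of_le_of_card_le {μ ν : YoungDiagram} (h : μ ≤ ν) (hc : ν.card ≤ μ.card) : μ = ν :=
  YoungDiagram.ext (Finset.eq_of_subset_of_card_le (cells_subset_iff.2 h) hc)

lemma card_mono {μ ν : YoungDiagram} (h : μ ≤ ν) : μ.card ≤ ν.card :=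
  Finset.card_le_card (cells_subset_iff.2 h)

lemma YCov_inf_of_YCov {lam μ ν : YoungDiagram} (hl : YCov lam ν) (hm : YCov μ ν)
    (hne : μ ≠ lam) : YCov (lam ⊓ μ) lam ∧ YCov (lam ⊓ μ) μ ∧ lam ⊔ μ = ν := by
  obtain ⟨hl, hlc⟩ := hl
  obtain ⟨hm, hmc⟩ := hm
  have hs := card_sup_add_card_inf lam μ
  have hle : lam ⊔ μ ≤ ν := sup_le hl hm
  have hlt : ¬ (lam ⊔ μ).card ≤ lam.card := fun h => hne <|
    eq_of_le_of_card_le (sup_eq_left.1 (eq_of_le_of_card_le le_sup_left h).symm) (by omega)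
  have := card_mono hle
  exact ⟨⟨inf_le_left, by omega⟩, ⟨inf_le_right, by omega⟩,
    eq_of_le_of_card_le hle (by omega)⟩

lemma YCov_sup_of_YCov {lam μ ν : YoungDiagram} (hl : YCov ν lam) (hm : YCov ν μ)
    (hne : μ ≠ lam) : YCov lam (lam ⊔ μ) ∧ YCov μ (lam ⊔ μ) ∧ lam ⊓ μ = ν := by
  obtain ⟨hl, hlc⟩ := hl
  obtain ⟨hm, hmc⟩ := hm
  have hs := card_sup_add_card_inf lam μ
  have hle : ν ≤ lam ⊓ μ := le_inf hl hm
  have hlt : ¬ lam.card ≤ (lam ⊓ μ).card := fun h => hne.symm <|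
    eq_of_le_of_card_le (inf_eq_left.1 (eq_of_le_of_card_le inf_le_left h)) (by omega)
  have := card_mono hle
  exact ⟨⟨le_sup_left, by omega⟩, ⟨le_sup_right, by omega⟩,
    (eq_of_le_of_card_le hle (by omega)).symm⟩

/-- Young's lattice is a `1`-differential poset: `D U = U D + 1`. -/
lemma sum_up_sum_down (lam : YoungDiagram) (g : YoungDiagram → ℕ) :
    ∑ ν ∈ lam.up, ∑ μ ∈ ν.down, g μ = g lam + ∑ ρ ∈ lam.down, ∑ μ ∈ ρ.up, g μ := by
  classical
  have h1 : ∑ ν ∈ lam.up, ∑ μ ∈ ν.down, g μ =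
      ∑ ν ∈ lam.up, (g lam + ∑ μ ∈ ν.down.erase lam, g μ) :=
    sum_congr rfl fun ν hν => (add_sum_erase _ _ (mem_down.2 (mem_up.1 hν))).symm
  have h2 : ∑ ρ ∈ lam.down, ∑ μ ∈ ρ.up, g μ =
      ∑ ρ ∈ lam.down, (g lam + ∑ μ ∈ ρ.up.erase lam, g μ) :=
    sum_congr rfl fun ρ hρ => (add_sum_erase _ _ (mem_up.2 (mem_down.1 hρ))).symm
  have h3 : ∑ ν ∈ lam.up, ∑ μ ∈ ν.down.erase lam, g μ =
      ∑ ρ ∈ lam.down, ∑ μ ∈ ρ.up.erase lam, g μ := by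
    rw [sum_sigma', sum_sigma']
    refine sum_bij' (fun x _ => ⟨lam ⊓ x.2, x.2⟩) (fun x _ => ⟨lam ⊔ x.2, x.2⟩) ?_ ?_ ?_ ?_ ?_
    · rintro ⟨ν, μ⟩ h
      simp only [mem_sigma, mem_erase, mem_up, mem_down] at h ⊢
      obtain ⟨h1, h2, -⟩ := YCov_inf_of_YCov h.1 h.2.2 h.2.1
      exact ⟨h1, h.2.1, h2⟩
    · rintro ⟨ν, μ⟩ h
      simp only [mem_sigma, mem_erase, mem_up, mem_down] at h ⊢
      obtain ⟨h1, h2, -⟩ := YCov_sup_of_YCov h.1 h.2.2 h.2.1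
      exact ⟨h1, h.2.1, h2⟩
    · rintro ⟨ν, μ⟩ h
      simp only [mem_sigma, mem_erase, mem_up, mem_down] at h ⊢
      rw [(YCov_inf_of_YCov h.1 h.2.2 h.2.1).2.2]
    · rintro ⟨ν, μ⟩ h
      simp only [mem_sigma, mem_erase, mem_up, mem_down] at h ⊢
      rw [(YCov_sup_of_YCov h.1 h.2.2 h.2.1).2.2]
    · intros; rfl
  rw [h1, h2, sum_add_distrib, sum_add_distrib, h3, sum_const, sum_const, card_up, smul_eq_mul,
    smul_eq_mul]
  ring

/-- The number of descending saturated chains of length `l` starting at a given diagram. -/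
noncomputable def numChains : ℕ → YoungDiagram → ℕ
  | 0, _ => 1
  | l + 1, μ => ∑ ν ∈ μ.down, numChains l ν

/-- The number of standard Young tableaux of a given shape. -/
noncomputable def numSYT (μ : YoungDiagram) : ℕ := numChains μ.card μ

lemma sum_down_numSYT {μ : YoungDiagram} {k : ℕ} (h : μ.card = k + 1) :
    ∑ ν ∈ μ.down, ν.numSYT = μ.numSYT := by
  rw [numSYT, h, numChains]
  refine sum_congr rfl fun ν hν => ?_
  have := (mem_down.1 hν).2
  rw [numSYT, show ν.card = k by omega]

lemma down_eq_empty {μ : YoungDiagram} (h : μ.card = 0) : μ.down = ∅ :=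
  eq_empty_of_forall_notMem fun ν hν => by
    have := (mem_down.1 hν).2
    omega

lemma sum_up_numSYT (k : ℕ) (μ : YoungDiagram) (h : μ.card = k) :
    ∑ ν ∈ μ.up, ν.numSYT = (k + 1) * μ.numSYT := by
  have h1 (μ : YoungDiagram) : ∑ ν ∈ μ.up, ν.numSYT = ∑ ν ∈ μ.up, ∑ ρ ∈ ν.down, ρ.numSYT :=
    sum_congr rfl fun ν hν => (sum_down_numSYT (mem_up.1 hν).2).symm
  induction k generalizing μ with
  | zero => rw [h1, sum_up_sum_down]; simp [down_eq_empty h]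
  | succ k ih =>
    have h2 : ∀ ρ ∈ μ.down, ∑ ν ∈ ρ.up, ν.numSYT = (k + 1) * ρ.numSYT := fun ρ hρ =>
      ih ρ (by have := (mem_down.1 hρ).2; omega)
    rw [h1, sum_up_sum_down, sum_congr rfl h2, ← mul_sum, sum_down_numSYT h]
    ring

open Classical in
/-- The neighbours of `μ` in the Hasse diagram of Young's lattice. -/
noncomputable def nbrs (μ : YoungDiagram) : Finset YoungDiagram := μ.down ∪ μ.up

lemma mem_nbrs {μ ν : YoungDiagram} : ν ∈ μ.nbrs ↔ YCov ν μ ∨ YCov μ ν := by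
  simp [nbrs, mem_up, mem_down]

lemma sum_nbrs (μ : YoungDiagram) (g : YoungDiagram → ℕ) :
    ∑ ν ∈ μ.nbrs, g ν = ∑ ν ∈ μ.down, g ν + ∑ ν ∈ μ.up, g ν := by
  classical
  refine sum_union (disjoint_left.2 fun ν h h' => ?_)
  have h1 := (mem_down.1 h).2
  have h2 := (mem_up.1 h').2
  omega

end YoungDiagram

open YoungDiagram

lemma sigma_oscTab_ext {s : Finset YoungDiagram} {l : ℕ} {x y : Σ μ : s, OscTab μ.1 l}
    (h : x.2.1 = y.2.1) : x = y := by
  obtain ⟨⟨μ, hμ⟩, ⟨S, hS⟩⟩ := x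
  obtain ⟨⟨ν, hν⟩, ⟨T, hT⟩⟩ := y
  obtain rfl : S = T := h
  obtain rfl : μ = ν := hS.2.1.symm.trans hT.2.1
  rfl

/-- Deleting the last diagram of an oscillating tableau gives one ending at a neighbour. -/
def oscTabSuccEquiv (lam : YoungDiagram) (l : ℕ) :
    OscTab lam (l + 1) ≃ Σ μ : lam.nbrs, OscTab μ.1 l where
  toFun T := ⟨⟨T.1 (Fin.last l).castSucc, mem_nbrs.2 <| by
      have h := T.2.2.2 (Fin.last l)
      rwa [Fin.succ_last, T.2.2.1] at h⟩,
    fun i => T.1 i.castSucc, T.2.1, rfl, fun i => T.2.2.2 i.castSucc⟩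
  invFun x := ⟨Fin.snoc (α := fun _ => YoungDiagram) x.2.1 lam, by
    obtain ⟨h0, hl, hS⟩ := x.2.2
    refine ⟨?_, by simp, fun i => ?_⟩
    · rw [← Fin.castSucc_zero', Fin.snoc_castSucc, h0]
    · induction i using Fin.lastCases with
      | last =>
        rw [Fin.succ_last, Fin.snoc_last, Fin.snoc_castSucc, hl]
        exact mem_nbrs.1 x.1.2
      | cast i =>
        rw [Fin.succ_castSucc, Fin.snoc_castSucc, Fin.snoc_castSucc]
        exact hS i⟩
  left_inv T := by
    apply Subtype.ext
    funext i
    induction i using Fin.lastCases with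
    | last => simp [T.2.2.1]
    | cast i => simp
  right_inv x := sigma_oscTab_ext <| funext fun i => by simp

lemma oscWt_oscTabSuccEquiv (lam : YoungDiagram) (l : ℕ) (T : OscTab lam (l + 1)) :
    oscWt T = oscWt (oscTabSuccEquiv lam l T).2 + lam.card := by
  rw [oscWt, Fin.sum_univ_castSucc, T.2.2.1]
  rfl

instance OscTab.instSubsingletonZero (lam : YoungDiagram) : Subsingleton (OscTab lam 0) :=
  ⟨fun S T => Subtype.ext <| funext fun i => by
    obtain rfl : i = 0 := Fin.fin_one_eq_zero i
    rw [S.2.1, T.2.1]⟩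

instance OscTab.instFinite (lam : YoungDiagram) (l : ℕ) : Finite (OscTab lam l) := by
  induction l generalizing lam with
  | zero => infer_instance
  | succ l ih => exact Finite.of_equiv _ (oscTabSuccEquiv lam l).symm

lemma card_oscTab_succ (lam : YoungDiagram) (l : ℕ) :
    Nat.card (OscTab lam (l + 1)) = ∑ μ ∈ lam.nbrs, Nat.card (OscTab μ l) := by
  rw [Nat.card_congr (oscTabSuccEquiv lam l), Nat.card_sigma,
    sum_coe_sort lam.nbrs fun μ => Nat.card (OscTab μ l)]

lemma finsum_oscWt_succ (lam : YoungDiagram) (l : ℕ) :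
    ∑ᶠ T : OscTab lam (l + 1), oscWt T =
      ∑ μ ∈ lam.nbrs, ∑ᶠ T : OscTab μ l, oscWt T +
        lam.card * Nat.card (OscTab lam (l + 1)) := by
  have := fun μ l => Fintype.ofFinite (OscTab μ l)
  simp only [finsum_eq_sum_of_fintype, oscWt_oscTabSuccEquiv, sum_add_distrib]
  rw [(oscTabSuccEquiv lam l).sum_comp fun x => oscWt x.2, Fintype.sum_sigma,
    sum_coe_sort lam.nbrs fun μ => ∑ T : OscTab μ l, oscWt T]
  simp [mul_comm]

/-- The number of oscillating tableaux of length `l` ending at a diagram with `k` boxes,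
divided by the number of standard Young tableaux of that shape. -/
def oscCount : ℕ → ℕ → ℕ
  | 0, 0 => 1
  | 0, _ + 1 => 0
  | l + 1, 0 => oscCount l 1
  | l + 1, k + 1 => oscCount l k + (k + 2) * oscCount l (k + 2)

/-- The total weight of the oscillating tableaux of length `l` ending at a diagram with `k` boxes,
divided by the number of standard Young tableaux of that shape. -/
def oscTotal : ℕ → ℕ → ℕ
  | 0, _ => 0
  | l + 1, 0 => oscTotal l 1
  | l + 1, k + 1 =>
    oscTotal l k + (k + 2) * oscTotal l (k + 2) + (k + 1) * oscCount (l + 1) (k + 1)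

lemma sum_nbrs_of_zero {lam : YoungDiagram} (h : lam.card = 0) (a : ℕ → ℕ) :
    ∑ μ ∈ lam.nbrs, a μ.card * μ.numSYT = a 1 * lam.numSYT := by
  rw [sum_nbrs, down_eq_empty h, sum_empty, zero_add]
  have h1 : ∀ μ ∈ lam.up, a μ.card * μ.numSYT = a 1 * μ.numSYT := fun μ hμ => by
    rw [(mem_up.1 hμ).2, h]
  rw [sum_congr rfl h1, ← mul_sum, sum_up_numSYT 0 lam h]
  ring

lemma sum_nbrs_of_succ {lam : YoungDiagram} {k : ℕ} (h : lam.card = k + 1) (a : ℕ → ℕ) :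
    ∑ μ ∈ lam.nbrs, a μ.card * μ.numSYT = (a k + (k + 2) * a (k + 2)) * lam.numSYT := by
  have h1 : ∀ μ ∈ lam.up, a μ.card * μ.numSYT = a (k + 2) * μ.numSYT := fun μ hμ => by
    rw [(mem_up.1 hμ).2, h]
  have h2 : ∀ μ ∈ lam.down, a μ.card * μ.numSYT = a k * μ.numSYT := fun μ hμ => by
    have := (mem_down.1 hμ).2
    rw [show μ.card = k by omega]
  rw [sum_nbrs, sum_congr rfl h1, sum_congr rfl h2, ← mul_sum, ← mul_sum,
    sum_up_numSYT _ lam h, sum_down_numSYT h]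
  ring

lemma card_oscTab (l : ℕ) (lam : YoungDiagram) :
    Nat.card (OscTab lam l) = oscCount l lam.card * lam.numSYT := by
  induction l generalizing lam with
  | zero =>
    rcases h : lam.card with _ | k
    · have hb : lam = ⊥ := (eq_of_le_of_card_le bot_le (by omega)).symm
      have : Nonempty (OscTab lam 0) := ⟨fun _ => ⊥, rfl, hb.symm, fun i => i.elim0⟩
      rw [Nat.card_of_subsingleton this.some, oscCount, numSYT, h, numChains]
    · have : IsEmpty (OscTab lam 0) := ⟨fun T => by
        have hb : lam = ⊥ := T.2.2.1.symm.trans T.2.1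
        simp [hb, YoungDiagram.card] at h⟩
      simp [oscCount]
  | succ l ih =>
    rw [card_oscTab_succ, sum_congr rfl fun μ _ => ih μ]
    rcases h : lam.card with _ | k
    · rw [sum_nbrs_of_zero h, oscCount]
    · rw [sum_nbrs_of_succ h, oscCount]

lemma finsum_oscWt (l : ℕ) (lam : YoungDiagram) :
    ∑ᶠ T : OscTab lam l, oscWt T = oscTotal l lam.card * lam.numSYT := by
  induction l generalizing lam with
  | zero =>
    have h0 : ∀ T : OscTab lam 0, oscWt T = 0 := fun T => by
      simp [oscWt, T.2.1]
    simp [h0, oscTotal]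
  | succ l ih =>
    rw [finsum_oscWt_succ, sum_congr rfl fun μ _ => ih μ, card_oscTab]
    rcases h : lam.card with _ | k
    · rw [sum_nbrs_of_zero h, oscTotal]; ring
    · rw [sum_nbrs_of_succ h, oscTotal]; ring

lemma oscCount_of_lt {l k : ℕ} (h : l < k) : oscCount l k = 0 := by
  induction l generalizing k with
  | zero => obtain ⟨k, rfl⟩ := Nat.exists_eq_succ_of_ne_zero h.ne'; rfl
  | succ l ih =>
    obtain ⟨k, rfl⟩ := Nat.exists_eq_succ_of_ne_zero (by omega : k ≠ 0)
    simp [oscCount, ih (show l < k by omega), ih (show l < k + 2 by omega)]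

lemma oscTotal_of_lt {l k : ℕ} (h : l < k) : oscTotal l k = 0 := by
  induction l generalizing k with
  | zero => rw [oscTotal]
  | succ l ih =>
    obtain ⟨k, rfl⟩ := Nat.exists_eq_succ_of_ne_zero (by omega : k ≠ 0)
    simp [oscTotal, ih (show l < k by omega), ih (show l < k + 2 by omega), oscCount_of_lt h]

open Nat in
lemma oscCount_mul {l k n : ℕ} (h : l = k + 2 * n) :
    (oscCount l k * (k ! * 2 ^ n * n !) : ℤ) = l ! := by
  induction l generalizing k n with
  | zero =>
    obtain rfl : k = 0 := by omega
    obtain rfl : n = 0 := by omega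
    simp [oscCount]
  | succ l ih =>
    have hl : (l : ℤ) + 1 = k + 2 * n := mod_cast h
    rcases k with _ | k <;> rcases n with _ | n
    · omega
    · have h1 := ih (k := 1) (n := n) (by omega)
      simp only [oscCount, factorial_succ, pow_succ] at h1 ⊢
      push_cast at h1 hl ⊢
      linear_combination (2 * (n + 1) : ℤ) * h1 - (l ! : ℤ) * hl
    · have h1 := ih (k := k) (n := 0) (by omega)
      simp only [oscCount, factorial_succ, oscCount_of_lt (show l < k + 2 by omega)] at h1 ⊢
      push_cast at h1 hl ⊢
      linear_combination (k + 1 : ℤ) * h1 - (l ! : ℤ) * hl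
    · have h1 := ih (k := k) (n := n + 1) (by omega)
      have h2 := ih (k := k + 2) (n := n) (by omega)
      simp only [oscCount, factorial_succ, pow_succ] at h1 h2 ⊢
      push_cast at h1 h2 hl ⊢
      linear_combination (k + 1 : ℤ) * h1 + (2 * (n + 1) : ℤ) * h2 - (l ! : ℤ) * hl

open Nat in
lemma oscTotal_mul {l k n : ℕ} (h : l = k + 2 * n) :
    (6 * oscTotal l k * (k ! * 2 ^ n * n !) : ℤ) =
      (4 * n ^ 2 + 3 * k ^ 2 + 8 * k * n + 2 * n + 3 * k) * l ! := by
  induction l generalizing k n with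
  | zero =>
    obtain rfl : k = 0 := by omega
    obtain rfl : n = 0 := by omega
    simp [oscTotal]
  | succ l ih =>
    have hl : (l : ℤ) = k + 2 * n - 1 := by omega
    have hC := oscCount_mul h
    rcases k with _ | k <;> rcases n with _ | n
    · omega
    · have h1 := ih (k := 1) (n := n) (by omega)
      simp only [oscTotal, factorial_succ, pow_succ] at h1 ⊢
      push_cast at h1 hl ⊢
      rw [hl]
      linear_combination (2 * (n + 1) : ℤ) * h1
    · have h1 := ih (k := k) (n := 0) (by omega)
      simp only [oscTotal, factorial_succ, oscTotal_of_lt (show l < k + 2 by omega)] at h1 hC ⊢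
      push_cast at h1 hl hC ⊢
      rw [hl] at hC ⊢
      linear_combination (k + 1 : ℤ) * h1 + 6 * (k + 1 : ℤ) * hC
    · have h1 := ih (k := k) (n := n + 1) (by omega)
      have h2 := ih (k := k + 2) (n := n) (by omega)
      simp only [oscTotal, factorial_succ, pow_succ] at h1 h2 hC ⊢
      push_cast at h1 h2 hl hC ⊢
      rw [hl] at hC ⊢
      linear_combination (k + 1 : ℤ) * h1 + (2 * (n + 1) : ℤ) * h2 + 6 * (k + 1 : ℤ) * hC

open Nat in
lemma six_mul_oscTotal (k n : ℕ) :
    6 * oscTotal (k + 2 * n) k =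
      (4 * n ^ 2 + 3 * k ^ 2 + 8 * k * n + 2 * n + 3 * k) * oscCount (k + 2 * n) k := by
  have hpos : 0 < k ! * 2 ^ n * n ! := by positivity
  refine Nat.eq_of_mul_eq_mul_right hpos ?_
  zify
  rw [oscTotal_mul rfl, mul_assoc (_ + _), oscCount_mul rfl]

end

/-- **Theorem 2 (main theorem).**  If `|λ| = k` then for all `n`, the average of `wt(T)` over
`T ∈ OT(λ, k + 2n)` equals `(4n² + 3k² + 8kn + 2n + 3k)/6`; equivalently (clearing the
denominator `6`), six times the total weight equals `(4n² + 3k² + 8kn + 2n + 3k)` times the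
number of tableaux. -/
theorem average_weight_oscillating_tableaux (lam : YoungDiagram) (k : ℕ) (hk : lam.card = k)
    (n : ℕ) :
    6 * (∑ᶠ T : OscTab lam (k + 2 * n), oscWt T) =
      (4 * n ^ 2 + 3 * k ^ 2 + 8 * k * n + 2 * n + 3 * k) *
        Nat.card (OscTab lam (k + 2 * n)) := by
  rw [finsum_oscWt, card_oscTab, hk, ← mul_assoc, six_mul_oscTotal, mul_assoc]
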